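/- If G is a k-outerplanar plane graph, then its weak dual G⁺ (with its induced plane embedding) is at most k-outerplanar. -/

import Mathlib

open Set Bornology

/-- A plane embedding of a simple graph: each vertex is mapped to a point of the
plane, each edge to an injective arc joining its endpoints; arcs avoid vertices
other than their endpoints and distinct arcs meet only at common endpoints. -/
structure PlaneEmbedding {V : Type} (G : SimpleGraph V) where
  pos : V → ℝ × ℝ
  pos_inj : Function.Injective pos
  arc : G.edgeSet → Set (ℝ × ℝ)
  arc_path : ∀ e : G.edgeSet, ∃ u v : V, (e : Sym2 V) = s(u, v) ∧
    ∃ γ : Path (pos u) (pos v), Function.Injective ⇑γ ∧ Set.range ⇑γ = arc e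
  arc_avoid : ∀ (e : G.edgeSet) (w : V), pos w ∈ arc e → w ∈ (e : Sym2 V)
  arc_inter : ∀ e f : G.edgeSet, e ≠ f → ∀ x ∈ arc e ∩ arc f,
    ∃ w : V, w ∈ (e : Sym2 V) ∧ w ∈ (f : Sym2 V) ∧ x = pos w

namespace PlaneEmbedding

variable {V : Type} {G : SimpleGraph V}

/-- The image (drawing) of the plane graph in the plane. -/
def image (P : PlaneEmbedding G) : Set (ℝ × ℝ) :=
  Set.range P.pos ∪ ⋃ e : G.edgeSet, P.arc e

/-- A face: a connected component of the complement of the image. -/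
def IsFace (P : PlaneEmbedding G) (f : Set (ℝ × ℝ)) : Prop :=
  ∃ x, x ∉ P.image ∧ f = connectedComponentIn (P.image)ᶜ x

def IsBoundedFace (P : PlaneEmbedding G) (f : Set (ℝ × ℝ)) : Prop :=
  P.IsFace f ∧ IsBounded f

def IsOuterFace (P : PlaneEmbedding G) (f : Set (ℝ × ℝ)) : Prop :=
  P.IsFace f ∧ ¬ IsBounded f

/-- The vertices on the boundary of a face `f`. -/
def boundaryVerts (P : PlaneEmbedding G) (f : Set (ℝ × ℝ)) : Set V :=
  {v | P.pos v ∈ closure f}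

/-- The weak dual: vertices are the bounded faces, two distinct faces being
adjacent when some edge lies on the boundary of both. -/
def weakDual (P : PlaneEmbedding G) :
    SimpleGraph {f : Set (ℝ × ℝ) // P.IsBoundedFace f} :=
  SimpleGraph.fromRel fun f g =>
    ∃ e : G.edgeSet, P.arc e ⊆ closure f.1 ∧ P.arc e ⊆ closure g.1

/-- `u⁺`: the bounded faces having `u` on their boundary. -/
def uPlus (P : PlaneEmbedding G) (u : V) :
    Set {f : Set (ℝ × ℝ) // P.IsBoundedFace f} :=
  {f | u ∈ P.boundaryVerts f.1}

/-- The drawing of the subgraph induced by a set `S` of vertices. -/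
def subImage (P : PlaneEmbedding G) (S : Set V) : Set (ℝ × ℝ) :=
  P.pos '' S ∪ ⋃ e ∈ {e : G.edgeSet | ∀ w, w ∈ (e : Sym2 V) → w ∈ S}, P.arc e

/-- The vertices of `S` lying on the boundary of the unbounded face of the
drawing of the subgraph induced by `S`. -/
def outerVerts (P : PlaneEmbedding G) (S : Set V) : Set V :=
  {v | v ∈ S ∧ ∃ x, x ∉ P.subImage S ∧
    ¬ IsBounded (connectedComponentIn (P.subImage S)ᶜ x) ∧
    P.pos v ∈ closure (connectedComponentIn (P.subImage S)ᶜ x)}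

/-- Remove the outer layer of vertices. -/
def peel (P : PlaneEmbedding G) (S : Set V) : Set V := S \ P.outerVerts S

/-- The embedding is (at most) `k`-outerplanar: `k` rounds of removing the
vertices on the outer boundary remove every vertex. -/
def OuterplanarAtMost (P : PlaneEmbedding G) (k : ℕ) : Prop :=
  (P.peel)^[k] Set.univ = ∅

/-- The drawing of the subgraph of all edges incident to vertices of `R`. -/
def familyImage (P : PlaneEmbedding G) (R : Set V) : Set (ℝ × ℝ) :=
  ⋃ e ∈ {e : G.edgeSet | ∃ v ∈ R, v ∈ (e : Sym2 V)}, P.arc e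

/-- `R` is nicely embedded: no bounded face of the subgraph of edges incident
to `R` strictly encloses a vertex of `G`. -/
def NicelyEmbedded (P : PlaneEmbedding G) (R : Set V) : Prop :=
  ∀ x, x ∉ P.familyImage R →
    IsBounded (connectedComponentIn (P.familyImage R)ᶜ x) →
    ∀ v : V, P.pos v ∉ connectedComponentIn (P.familyImage R)ᶜ x

/-- The facial completion: add a clique on the boundary of each bounded face. -/
def facialCompletion (P : PlaneEmbedding G) : SimpleGraph V :=
  G ⊔ SimpleGraph.fromRel fun u v =>
    ∃ f, P.IsBoundedFace f ∧ u ∈ P.boundaryVerts f ∧ v ∈ P.boundaryVerts f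

end PlaneEmbedding

/-- A tree together with a bag of vertices at each node. -/
structure Decomp (V : Type) : Type 1 where
  ι : Type
  tree : SimpleGraph ι
  isTree : tree.IsTree
  bag : ι → Set V

/-- `D` is a tree decomposition of `G`. -/
def IsTreeDecomp {V : Type} (G : SimpleGraph V) (D : Decomp V) : Prop :=
  (∀ v, ∃ i, v ∈ D.bag i) ∧
  (∀ u v, G.Adj u v → ∃ i, u ∈ D.bag i ∧ v ∈ D.bag i) ∧
  (∀ v, (D.tree.induce {i | v ∈ D.bag i}).Connected)

/-- The treewidth of a graph. -/
noncomputable def treewidth {V : Type} (G : SimpleGraph V) : ℕ :=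
  sInf {k | ∃ D : Decomp V, IsTreeDecomp G D ∧ ∀ i, (D.bag i).ncard ≤ k + 1}

/-- `D` is an embedded tree decomposition of the plane graph given by `P`. -/
def IsEmDecomp {V : Type} {G : SimpleGraph V} (P : PlaneEmbedding G)
    (D : Decomp V) : Prop :=
  IsTreeDecomp G D ∧ ∀ f, P.IsBoundedFace f → ∃ i, P.boundaryVerts f ⊆ D.bag i

/-- The em-width of a plane graph. -/
noncomputable def emwidth {V : Type} {G : SimpleGraph V}
    (P : PlaneEmbedding G) : ℕ :=
  sInf {k | ∃ D : Decomp V, IsEmDecomp P D ∧ ∀ i, (D.bag i).ncard ≤ k + 1}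

/-- A cut vertex: its removal disconnects two vertices that were connected. -/
def SimpleGraph.IsCutVertex {V : Type} (G : SimpleGraph V) (u : V) : Prop :=
  ∃ x y, ∃ (hx : x ≠ u) (hy : y ≠ u), G.Reachable x y ∧
    ¬ (G.induce {v | v ≠ u}).Reachable ⟨x, hx⟩ ⟨y, hy⟩

/-- An `r`-family: `r` vertices of degree 2 sharing the same two neighbors. -/
def IsRFamily {V : Type} (G : SimpleGraph V) (R : Set V) (r : ℕ) : Prop :=
  R.ncard = r ∧ ∃ a b : V, a ≠ b ∧ ∀ v ∈ R, G.neighborSet v = {a, b}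


/-- An embedding `Q` of the weak dual of `P` is compatible with (induced by) `P` when
every dual vertex is placed inside the corresponding bounded face, and every dual arc
meets the primal drawing in exactly one point, which is an interior point of an arc of
a primal edge lying on the boundary of both faces joined by the dual edge. -/
def IsCompatibleDualEmbedding {V : Type} {G : SimpleGraph V}
    (P : PlaneEmbedding G) (Q : PlaneEmbedding P.weakDual) : Prop :=
  (∀ f : {f : Set (ℝ × ℝ) // P.IsBoundedFace f}, Q.pos f ∈ f.1) ∧
  (∀ d : P.weakDual.edgeSet,
    ∃ (f g : {f : Set (ℝ × ℝ) // P.IsBoundedFace f}) (e : G.edgeSet),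
      (d : Sym2 {f : Set (ℝ × ℝ) // P.IsBoundedFace f}) = s(f, g) ∧
      P.arc e ⊆ closure f.1 ∧ P.arc e ⊆ closure g.1 ∧
      ∃ x, Q.arc d ∩ P.image = {x} ∧ x ∈ P.arc e ∧ x ∉ Set.range P.pos)

/-- The standard identification of the real plane with the complex numbers. -/
noncomputable abbrev planeToComplex : (ℝ × ℝ) ≃L[ℝ] ℂ := Complex.equivRealProdCLM.symm

local notation "τ" => planeToComplex

theorem exists_continuous_clog {X : Type*} [TopologicalSpace X] [SimplyConnectedSpace X]
    [LocallyPathConnectedSpace X] {H : X → ℂ} (hH : Continuous H) (h0 : ∀ x, H x ≠ 0) :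
    ∃ L : X → ℂ, Continuous L ∧ ∀ x, Complex.exp (L x) = H x := by
  obtain ⟨x₀⟩ : Nonempty X := inferInstance
  obtain ⟨F, ⟨-, hF⟩, -⟩ := Complex.isCoveringMapOn_exp.existsUnique_continuousMap_lifts
    ⟨H, hH⟩ (a₀ := x₀) (Complex.exp_log (h0 x₀)) (fun x => h0 x)
  exact ⟨F, F.continuous, fun x => congrFun hF x⟩

/-- A nonvanishing continuous function on the plane which agrees with `z ↦ (z - p) ^ m` far away
from `p` forces `m = 0`. -/
theorem exponent_eq_zero_of_eq_zpow_outside {H : ℝ × ℝ → ℂ} (hH : Continuous H)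
    (h0 : ∀ z, H z ≠ 0) {p : ℝ × ℝ} {R : ℝ} (hR : 0 < R) {m : ℤ}
    (hm : ∀ z, R ≤ ‖τ z - τ p‖ → H z = (τ z - τ p) ^ m) : m = 0 := by
  obtain ⟨L, hL, hexp⟩ := exists_continuous_clog hH h0
  let c : ℝ → ℝ × ℝ := fun t => (τ).symm (τ p + R * Complex.exp (t * Complex.I))
  have hc : Continuous c := by fun_prop
  have hτc : ∀ t, τ (c t) - τ p = R * Complex.exp (t * Complex.I) := by
    intro t; simp only [c, ContinuousLinearEquiv.apply_symm_apply]; ring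
  have hRc : (R : ℂ) ≠ 0 := by exact_mod_cast hR.ne'
  have hval : ∀ t : ℝ, Complex.exp (L (c t)) = (R : ℂ) ^ m * Complex.exp (m * (t * Complex.I)) := by
    intro t
    rw [hexp, hm _ (by rw [hτc]; simp [abs_of_pos hR, Complex.norm_exp]), hτc, mul_zpow,
      Complex.exp_int_mul]
  have key := Complex.isCoveringMap_exp.eq_of_comp_eq (A := ℝ) (g₁ := fun t => L (c t))
    (g₂ := fun t => L (c 0) + m * (t * Complex.I)) (by fun_prop) (by fun_prop)
    (by
      funext t
      apply Subtype.ext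
      have h := hval 0
      simp only [Function.comp, Complex.exp_add, hval]
      simp) 0 (by simp)
  have h2 := congrFun key (2 * Real.pi)
  have hcc : c (2 * Real.pi) = c 0 := by
    simp only [c]; congr 3; push_cast; rw [Complex.exp_two_pi_mul_I]; simp
  simp only [hcc] at h2
  have h3 : (m : ℂ) * ((2 * Real.pi : ℝ) * Complex.I) = 0 := by simpa using h2
  simpa [Real.pi_ne_zero, Complex.I_ne_zero] using h3

/-- If `p` lies in a bounded open set `C`, then `z ↦ (z - p) ^ m * F z` with `m ≠ 0` has no
continuous logarithm on the frontier of `C`, as long as `F` extends to `C` without zeros. -/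
theorem not_exists_clog_on_frontier {C : Set (ℝ × ℝ)} (hC : IsOpen C) (hb : IsBounded C)
    {p : ℝ × ℝ} (hp : p ∈ C) {m : ℤ} (hm : m ≠ 0) {F : ℝ × ℝ → ℂ}
    (hF : ContinuousOn F (closure C)) (hF0 : ∀ z ∈ closure C, F z ≠ 0) {g : ℝ × ℝ → ℂ}
    (hg : ContinuousOn g (frontier C))
    (hexp : ∀ z ∈ frontier C, Complex.exp (g z) = (τ z - τ p) ^ m * F z) : False := by
  classical
  obtain ⟨G, hG⟩ := ContinuousMap.exists_restrict_eq (isClosed_frontier (s := C))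
    (⟨(frontier C).domRestrict g, continuousOn_iff_continuous_domRestrict.mp hg⟩ : C(frontier C, ℂ))
  have hGg : ∀ z ∈ frontier C, G z = g z := fun z hz => by
    simpa using congrArg (fun f : C(frontier C, ℂ) => f ⟨z, hz⟩) hG
  have hne : ∀ z ∉ C, τ z - τ p ≠ 0 := fun z hz h =>
    hz (by rw [(τ).injective (sub_eq_zero.mp h)]; exact hp)
  let H : ℝ × ℝ → ℂ := fun z => if z ∈ C then Complex.exp (G z) / F z else (τ z - τ p) ^ m
  have hH : Continuous H := by
    apply continuous_if
    · intro z hz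
      rw [hGg z hz, hexp z hz, mul_div_cancel_right₀ _ (hF0 z (frontier_subset_closure hz))]
    · exact (Complex.continuous_exp.comp G.continuous).continuousOn.div hF hF0
    · have : closure {z | z ∉ C} = Cᶜ := hC.isClosed_compl.closure_eq
      rw [this]
      exact ContinuousOn.zpow₀ (by fun_prop) m fun z hz => Or.inl (hne z hz)
  have hH0 : ∀ z, H z ≠ 0 := by
    intro z
    by_cases hz : z ∈ C
    · simpa [H, hz, Complex.exp_ne_zero] using hF0 z (subset_closure hz)
    · simpa only [H, hz, if_false] using zpow_ne_zero m (hne z hz)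
  obtain ⟨R, hR⟩ := (hb.isCompact_closure.image_of_continuousOn
    (f := fun z => ‖τ z - τ p‖) (by fun_prop)).isBounded.bddAbove
  refine hm (exponent_eq_zero_of_eq_zpow_outside hH hH0 (p := p) (R := |R| + 1) (by positivity) ?_)
  intro z hz
  have : z ∉ C := by
    intro hzC
    have := hR (mem_image_of_mem _ (subset_closure hzC))
    have := le_abs_self R
    linarith
  simp only [H, this, if_false]

/-- A nonvanishing continuous function on a subarc of a simple arc has a continuous logarithm. -/
theorem exists_clog_on_arc {a b : ℝ × ℝ} (γ : Path a b) (hγ : Function.Injective γ)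
    {s u : unitInterval} (hsu : s ≤ u) {f : ℝ × ℝ → ℂ} (hf : ContinuousOn f (γ '' Icc s u))
    (h0 : ∀ z ∈ γ '' Icc s u, f z ≠ 0) :
    ∃ h : ℝ × ℝ → ℂ, ContinuousOn h (γ '' Icc s u) ∧
      ∀ z ∈ γ '' Icc s u, Complex.exp (h z) = f z := by
  let r : ℝ → unitInterval := fun t => max s (min u (projIcc 0 1 zero_le_one t))
  have hr : Continuous r := by
    have := continuous_projIcc (h := zero_le_one (α := ℝ)); fun_prop
  have hrmem : ∀ t, γ (r t) ∈ γ '' Icc s u := fun t =>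
    mem_image_of_mem _ ⟨le_max_left _ _, max_le hsu (min_le_left _ _)⟩
  obtain ⟨L, hL, hexp⟩ := exists_continuous_clog (X := ℝ) (H := fun t => f (γ (r t)))
    (hf.comp_continuous (γ.continuous.comp hr) hrmem) (fun t => h0 _ (hrmem t))
  have hemb : Topology.IsClosedEmbedding γ := γ.continuous.isClosedEmbedding hγ
  let e := hemb.isEmbedding.toHomeomorph
  obtain ⟨h, hh⟩ : ∃ h : ℝ × ℝ → ℂ, ∀ t : unitInterval, h (γ t) = L t :=
    ⟨Function.extend γ (fun t => L t) 0, fun t => hγ.extend_apply _ _ _⟩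
  refine ⟨h, ContinuousOn.mono (s := range γ) ?_ (image_subset_range _ _), ?_⟩
  · rw [continuousOn_iff_continuous_domRestrict]
    have : (range γ).domRestrict h = fun z => L (e.symm z) := by
      funext z
      obtain ⟨t, rfl⟩ := e.surjective z
      simp [e, hh]
    rw [this]
    fun_prop
  · rintro _ ⟨t, ht, rfl⟩
    rw [hh, hexp]
    simp [r, ht.1, ht.2]

/-- Continuous logarithms on two closed sets meeting in at most one point can be glued. -/
theorem exists_clog_union {f : ℝ × ℝ → ℂ} {A B : Set (ℝ × ℝ)} (hA : IsClosed A)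
    (hB : IsClosed B) {c : ℝ × ℝ} (hAB : A ∩ B ⊆ {c})
    (h₁ : ∃ g : ℝ × ℝ → ℂ, ContinuousOn g A ∧ ∀ z ∈ A, Complex.exp (g z) = f z)
    (h₂ : ∃ g : ℝ × ℝ → ℂ, ContinuousOn g B ∧ ∀ z ∈ B, Complex.exp (g z) = f z) :
    ∃ g : ℝ × ℝ → ℂ, ContinuousOn g (A ∪ B) ∧ ∀ z ∈ A ∪ B, Complex.exp (g z) = f z := by
  classical
  obtain ⟨g₁, hg₁, he₁⟩ := h₁
  obtain ⟨g₂, hg₂, he₂⟩ := h₂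
  obtain ⟨d, hd, hdc⟩ : ∃ d : ℂ, Complex.exp d = 1 ∧ ∀ z ∈ A ∩ B, g₁ z = g₂ z + d := by
    by_cases hc : c ∈ A ∩ B
    · refine ⟨g₁ c - g₂ c, ?_, fun z hz => ?_⟩
      · rw [Complex.exp_sub, he₁ c hc.1, he₂ c hc.2, div_self]
        rw [← he₁ c hc.1]
        exact Complex.exp_ne_zero _
      · rw [mem_singleton_iff.mp (hAB hz)]; ring
    · refine ⟨0, Complex.exp_zero, fun z hz => absurd ?_ hc⟩
      rwa [mem_singleton_iff.mp (hAB hz)] at hz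
  have hB' : ∀ z ∈ B, (if z ∈ A then g₁ z else g₂ z + d) = g₂ z + d := by
    intro z hz
    split_ifs with h
    exacts [hdc z ⟨h, hz⟩, rfl]
  refine ⟨fun z => if z ∈ A then g₁ z else g₂ z + d, ?_, ?_⟩
  · refine ContinuousOn.union_of_isClosed (hg₁.congr fun z hz => if_pos hz) ?_ hA hB
    exact (hg₂.add_const d).congr hB'
  · rintro z (hz | hz)
    · simp only [hz, if_true, he₁ z hz]
    · simp only [hB' z hz, Complex.exp_add, hd, he₂ z hz, mul_one]

/-- If `p` and `q` are in a disc about `c` avoiding `N`, then `(z - p) / (z - q)` has a continuous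
logarithm on `N`. -/
theorem exists_clog_off_ball {N : Set (ℝ × ℝ)} {c p q : ℝ × ℝ} {r : ℝ}
    (hN : ∀ z ∈ N, r ≤ ‖τ z - τ c‖) (hp : ‖τ p - τ c‖ < r) (hq : ‖τ q - τ c‖ < r) :
    ∃ g : ℝ × ℝ → ℂ, ContinuousOn g N ∧
      ∀ z ∈ N, Complex.exp (g z) = (τ z - τ p) * (τ z - τ q)⁻¹ := by
  have hr : 0 < r := (norm_nonneg _).trans_lt hp
  have hne : ∀ z ∈ N, τ z - τ c ≠ 0 := fun z hz h => by
    have := hN z hz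
    rw [h, norm_zero] at this
    linarith
  have slit : ∀ w : ℝ × ℝ, ‖τ w - τ c‖ < r → ∀ z ∈ N,
      1 + -((τ w - τ c) / (τ z - τ c)) ∈ Complex.slitPlane := fun w hw z hz =>
    Complex.mem_slitPlane_of_norm_lt_one (by
      rw [norm_neg, norm_div, div_lt_one (norm_pos_iff.mpr (hne z hz))]
      exact hw.trans_le (hN z hz))
  have hcont : ∀ w : ℝ × ℝ, ‖τ w - τ c‖ < r →
      ContinuousOn (fun z => Complex.log (1 + -((τ w - τ c) / (τ z - τ c)))) N := fun w hw =>
    ContinuousOn.clog (continuousOn_const.add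
      (ContinuousOn.neg (continuousOn_const.div (by fun_prop) hne))) (slit w hw)
  refine ⟨fun z => Complex.log (1 + -((τ p - τ c) / (τ z - τ c))) -
    Complex.log (1 + -((τ q - τ c) / (τ z - τ c))), (hcont p hp).sub (hcont q hq), fun z hz => ?_⟩
  have hz0 := hne z hz
  have h1 := Complex.slitPlane_ne_zero (slit p hp z hz)
  have h2 := Complex.slitPlane_ne_zero (slit q hq z hz)
  have e : ∀ w : ℝ × ℝ, 1 + -((τ w - τ c) / (τ z - τ c)) = (τ z - τ w) / (τ z - τ c) := by
    intro w
    field_simp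
    ring
  rw [Complex.exp_sub, Complex.exp_log h1, Complex.exp_log h2, e, e,
    div_div_div_cancel_right₀ hz0, div_eq_mul_inv]

/-- Two points on different sides of an open set `C`, one of `C` and its complement being bounded,
leave no continuous logarithm of `(z - p) / (z - q)` on the frontier of `C`. -/
theorem not_exists_clog_div_on_frontier {C : Set (ℝ × ℝ)} (hC : IsOpen C)
    (hb : IsBounded C ∨ IsBounded Cᶜ) {p q : ℝ × ℝ} (hp : p ∈ C) (hq : q ∉ closure C)
    {g : ℝ × ℝ → ℂ} (hg : ContinuousOn g (frontier C))
    (hexp : ∀ z ∈ frontier C, Complex.exp (g z) = (τ z - τ p) * (τ z - τ q)⁻¹) : False := by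
  rcases hb with hb | hb
  · have hne : ∀ z ∈ closure C, τ z - τ q ≠ 0 := fun z hz h =>
      hq (by rwa [← (τ).injective (sub_eq_zero.mp h)])
    refine not_exists_clog_on_frontier hC hb hp one_ne_zero (F := fun z => (τ z - τ q)⁻¹)
      (ContinuousOn.inv₀ (by fun_prop) hne) (fun z hz => inv_ne_zero (hne z hz)) hg ?_
    simpa using hexp
  · have hsub : frontier (closure C)ᶜ ⊆ frontier C := by
      rw [frontier_compl]; exact frontier_closure_subset
    have hne : ∀ z ∈ closure (closure C)ᶜ, τ z - τ p ≠ 0 := fun z hz h => by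
      have hpz := (τ).injective (sub_eq_zero.mp h)
      have : closure (closure C)ᶜ ⊆ Cᶜ :=
        closure_minimal (compl_subset_compl.mpr subset_closure) hC.isClosed_compl
      exact this hz (hpz ▸ hp)
    refine not_exists_clog_on_frontier isClosed_closure.isOpen_compl
      (hb.subset (compl_subset_compl.mpr subset_closure)) (p := q) hq
      (neg_ne_zero.mpr one_ne_zero) (F := fun z => τ z - τ p) (by fun_prop) hne (hg.mono hsub) ?_
    intro z hz
    rw [hexp z (hsub hz), zpow_neg_one, mul_comm]

/-- If the closure of `C` meets a simple arc in the frontier of `C` which is free at its interior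
points, then it contains the source of the arc, unless it only meets the arc at its target. -/
theorem source_mem_closure_of_arc {C N : Set (ℝ × ℝ)} (hC : IsOpen C)
    (hb : IsBounded C ∨ IsBounded Cᶜ) (hN : IsClosed N) {a b : ℝ × ℝ} (γ : Path a b)
    (hγ : Function.Injective γ) (hγN : ∀ t, t ≠ 0 → t ≠ 1 → γ t ∉ N)
    (hfr : frontier C ⊆ N ∪ range γ) (hCγ : ∀ t, γ t ∉ C) {t : unitInterval} (ht1 : t ≠ 1)
    (ht : γ t ∈ closure C) : a ∈ closure C := by
  by_contra ha
  have hTc : IsClosed {t | γ t ∈ closure C} := isClosed_closure.preimage γ.continuous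
  obtain ⟨s, hs, hmin⟩ := hTc.isCompact.exists_isLeast ⟨t, ht⟩
  have hs0 : s ≠ 0 := by
    rintro rfl
    exact ha (by simpa using hs)
  have hs1 : s < 1 := (hmin ht).trans_lt (lt_of_le_of_ne unitInterval.le_one' ht1)
  obtain ⟨u, hsu, hu1⟩ := exists_between hs1
  let M : Set (ℝ × ℝ) := frontier C ∩ (N ∪ γ '' Icc u 1)
  let J : Set (ℝ × ℝ) := γ '' Icc s u
  have hM : IsClosed M := isClosed_frontier.inter
    (hN.union (isCompact_Icc.image γ.continuous).isClosed)
  have hJ : IsClosed J := (isCompact_Icc.image γ.continuous).isClosed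
  have hJN : ∀ v ∈ Icc s u, γ v ∉ N := fun v hv =>
    hγN v (fun h => hs0 (le_antisymm (h ▸ hv.1) unitInterval.nonneg'))
      (fun h => (hv.2.trans_lt hu1).ne h)
  have hMJ : M ∩ J ⊆ {γ u} := by
    rintro _ ⟨⟨-, hz | ⟨w, hw, hwv⟩⟩, ⟨v, hv, rfl⟩⟩
    · exact absurd hz (hJN v hv)
    · have := hγ hwv
      subst this
      rw [le_antisymm hv.2 hw.1]
      rfl
  have hcover : frontier C ⊆ M ∪ J := by
    intro z hz
    rcases hfr hz with h | ⟨v, rfl⟩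
    · exact Or.inl ⟨hz, Or.inl h⟩
    · have hsv : s ≤ v := hmin (frontier_subset_closure hz)
      rcases le_total v u with h | h
      · exact Or.inr ⟨v, ⟨hsv, h⟩, rfl⟩
      · exact Or.inl ⟨hz, Or.inr ⟨v, ⟨h, unitInterval.le_one'⟩, rfl⟩⟩
  have hsM : γ s ∉ M := by
    rintro ⟨-, h | ⟨w, hw, hws⟩⟩
    · exact hJN s ⟨le_rfl, hsu.le⟩ h
    · exact absurd (hγ hws ▸ hw.1) (not_le.mpr hsu)
  obtain ⟨r, hr, hball⟩ := Metric.isOpen_iff.mp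
    ((τ).toHomeomorph.isClosedMap M hM).isOpen_compl (τ (γ s))
    (fun ⟨z, hz, h⟩ => hsM ((τ).injective h ▸ hz))
  have hMr : ∀ z ∈ M, r ≤ ‖τ z - τ (γ s)‖ := fun z hz => by
    by_contra! h
    exact hball (by rwa [Metric.mem_ball, dist_eq_norm]) ⟨z, hz, rfl⟩
  have hVo : IsOpen {z : ℝ × ℝ | ‖τ z - τ (γ s)‖ < r} := isOpen_lt (by fun_prop) (by fun_prop)
  have hsV : γ s ∈ {z : ℝ × ℝ | ‖τ z - τ (γ s)‖ < r} := by simpa using hr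
  obtain ⟨p, hpV, hpC⟩ := mem_closure_iff.mp hs _ hVo hsV
  obtain ⟨v, hvs, hvV⟩ : ∃ v < s, ‖τ (γ v) - τ (γ s)‖ < r := by
    have h0s : (0 : unitInterval) < s := lt_of_le_of_ne unitInterval.nonneg' hs0.symm
    have := (hVo.preimage γ.continuous).mem_nhds hsV
    obtain ⟨l, hl, hls⟩ := exists_Ioc_subset_of_mem_nhds this ⟨0, h0s⟩
    obtain ⟨v, hlv, hv⟩ := exists_between hl
    exact ⟨v, hv, hls ⟨hlv, hv.le⟩⟩
  have hqC : γ v ∉ closure C := fun h => absurd (hmin h) (not_le.mpr hvs)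
  have hJp : ∀ z ∈ J, τ z - τ p ≠ 0 := by
    rintro _ ⟨w, -, rfl⟩ h
    exact hCγ w ((τ).injective (sub_eq_zero.mp h) ▸ hpC)
  have hJq : ∀ z ∈ J, τ z - τ (γ v) ≠ 0 := by
    rintro _ ⟨w, hw, rfl⟩ h
    have := hγ ((τ).injective (sub_eq_zero.mp h))
    exact absurd (this ▸ hw.1) (not_le.mpr hvs)
  obtain ⟨g, hg, he⟩ := exists_clog_union hM hJ hMJ (exists_clog_off_ball hMr hpV hvV)
    (exists_clog_on_arc γ hγ hsu.le (ContinuousOn.mul (by fun_prop)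
      (ContinuousOn.inv₀ (by fun_prop) hJq))
      (fun z hz => mul_ne_zero (hJp z hz) (inv_ne_zero (hJq z hz))))
  exact not_exists_clog_div_on_frontier hC hb hpC hqC (hg.mono hcover)
    (fun z hz => he z (hcover hz))

/-- In the plane, the complement of an unbounded component of the complement of a bounded set is
bounded. -/
theorem isBounded_compl_of_unbounded_component {K : Set (ℝ × ℝ)} (hK : IsBounded K) {x : ℝ × ℝ}
    (hx : ¬ IsBounded (connectedComponentIn Kᶜ x)) :
    IsBounded (connectedComponentIn Kᶜ x)ᶜ := by
  have hbdd : ∀ r : ℝ, IsBounded {z : ℝ × ℝ | ‖τ z‖ ≤ r} := fun r => by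
    have : {z : ℝ × ℝ | ‖τ z‖ ≤ r} = (τ).toHomeomorph ⁻¹' Metric.closedBall 0 r := by
      ext z; simp
    rw [this]
    exact ((τ).toHomeomorph.isCompact_preimage.mpr (isCompact_closedBall 0 r)).isBounded
  obtain ⟨r, hr0, hr⟩ := (hK.isCompact_closure.image (τ).continuous).isBounded.exists_pos_norm_le
  let A : Set (ℝ × ℝ) := {z | r < ‖τ z‖}
  have hA : IsPreconnected A := by
    have himg : A = (fun w : ℝ × ℝ => (τ).symm (w.1 * Complex.exp (w.2 * Complex.I))) ''
        (Ioi r ×ˢ univ) := by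
      ext z
      constructor
      · intro hz
        refine ⟨(‖τ z‖, (τ z).arg), ⟨hz, mem_univ _⟩, ?_⟩
        simp only [Complex.norm_mul_exp_arg_mul_I, ContinuousLinearEquiv.symm_apply_apply]
      · rintro ⟨w, ⟨hw, -⟩, rfl⟩
        have hw' : r < w.1 := hw
        change r < ‖τ ((τ).symm _)‖
        rwa [ContinuousLinearEquiv.apply_symm_apply, norm_mul, Complex.norm_exp_ofReal_mul_I,
          mul_one, Complex.norm_real, Real.norm_of_nonneg (hr0.trans hw').le]
    rw [himg]
    exact (isPreconnected_Ioi.prod isPreconnected_univ).image _ (by fun_prop)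
  have hAK : A ⊆ Kᶜ := fun z hz hzK =>
    absurd (hr _ (mem_image_of_mem _ (subset_closure hzK))) (not_le.mpr hz)
  obtain ⟨y, hyC, hyA⟩ : ∃ y ∈ connectedComponentIn Kᶜ x, y ∈ A := by
    by_contra! h
    exact hx ((hbdd r).subset fun z hz => show ‖τ z‖ ≤ r from le_of_not_gt (h z hz))
  refine (hbdd r).subset fun z hz => show ‖τ z‖ ≤ r from le_of_not_gt fun hzA => hz ?_
  rw [connectedComponentIn_eq hyC]
  exact hA.subset_connectedComponentIn hyA hAK hzA

/-- A component of the complement of a closed plane set has its frontier in that set. -/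
theorem frontier_component_subset {K : Set (ℝ × ℝ)} (hK : IsClosed K) (x : ℝ × ℝ) :
    frontier (connectedComponentIn Kᶜ x) ⊆ K := by
  intro z hz
  by_contra hzK
  obtain ⟨y, hyz, hyx⟩ := mem_closure_iff.mp (frontier_subset_closure hz) _
    (hK.isOpen_compl.connectedComponentIn (x := z)) (mem_connectedComponentIn hzK)
  have hzx : z ∈ connectedComponentIn Kᶜ x := by
    rw [connectedComponentIn_eq hyx, ← connectedComponentIn_eq hyz]
    exact mem_connectedComponentIn hzK
  rw [hK.isOpen_compl.connectedComponentIn.frontier_eq] at hz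
  exact hz.2 hzx

/-- A point outside `L` in the closure of a connected set disjoint from `L` has this set in its
component of the complement of `L`. -/
theorem subset_component_of_mem_closure {C L : Set (ℝ × ℝ)} (hC : IsPreconnected C)
    (hCL : Disjoint C L) {z : ℝ × ℝ} (hz : z ∈ closure C) (hzL : z ∉ L) :
    C ⊆ connectedComponentIn Lᶜ z := by
  have h : IsPreconnected (insert z C) :=
    hC.subset_closure (subset_insert _ _) (insert_subset hz subset_closure)
  exact (subset_insert _ _).trans (h.subset_connectedComponentIn (mem_insert _ _)
    (insert_subset hzL hCL.subset_compl_right))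

namespace PlaneEmbedding

variable {V : Type} {G : SimpleGraph V} (P : PlaneEmbedding G)

theorem isCompact_arc (e : G.edgeSet) : IsCompact (P.arc e) := by
  obtain ⟨u, v, -, γ, -, h⟩ := P.arc_path e
  exact h ▸ isCompact_range γ.continuous

theorem isCompact_subImage [Finite V] (S : Set V) : IsCompact (P.subImage S) :=
  ((toFinite S).image P.pos).isCompact.union
    ((toFinite _).isCompact_biUnion fun e _ => P.isCompact_arc e)

theorem subImage_mono {S S' : Set V} (h : S ⊆ S') : P.subImage S ⊆ P.subImage S' :=
  union_subset_union (image_mono h)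
    (biUnion_subset_biUnion_left fun _ he w hw => h (he w hw))

theorem image_eq_subImage : P.image = P.subImage univ := by
  simp [image, subImage]

theorem isCompact_image [Finite V] : IsCompact P.image :=
  P.image_eq_subImage ▸ P.isCompact_subImage univ

theorem arc_subset_image (e : G.edgeSet) : P.arc e ⊆ P.image :=
  (subset_iUnion P.arc e).trans subset_union_right

theorem pos_mem_image (v : V) : P.pos v ∈ P.image := Or.inl (mem_range_self v)

theorem pos_mem_subImage_iff {S : Set V} {v : V} : P.pos v ∈ P.subImage S ↔ v ∈ S := by
  refine ⟨?_, fun h => Or.inl (mem_image_of_mem _ h)⟩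
  rintro (⟨w, hw, h⟩ | h)
  · exact P.pos_inj h ▸ hw
  · obtain ⟨e, he, h⟩ := mem_iUnion₂.mp h
    exact he v (P.arc_avoid e v h)

/-- An edge with an interior point in the closure of a face has its ends there. -/
theorem pos_mem_closure_of_edge [Finite V] {S : Set V} (x : ℝ × ℝ) {e : G.edgeSet}
    (he : ∀ w ∈ (e : Sym2 V), w ∈ S) {z : ℝ × ℝ} (hz : z ∈ P.arc e) (hzp : z ∉ range P.pos)
    (hzC : z ∈ closure (connectedComponentIn (P.subImage S)ᶜ x)) {w : V}
    (hw : w ∈ (e : Sym2 V)) : P.pos w ∈ closure (connectedComponentIn (P.subImage S)ᶜ x) := by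
  obtain ⟨u, v, huv, γ, hγ, hr⟩ := P.arc_path e
  let C := connectedComponentIn (P.subImage S)ᶜ x
  have hK := (P.isCompact_subImage S)
  have hC : IsOpen C := hK.isClosed.isOpen_compl.connectedComponentIn
  have hb : IsBounded C ∨ IsBounded Cᶜ :=
    or_iff_not_imp_left.mpr (isBounded_compl_of_unbounded_component hK.isBounded)
  let N := P.pos '' S ∪ ⋃ e' ∈ {e' : G.edgeSet | e' ≠ e ∧ ∀ w ∈ (e' : Sym2 V), w ∈ S}, P.arc e'
  have hN : IsClosed N := (((toFinite S).image P.pos).isCompact.union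
    ((toFinite _).isCompact_biUnion fun e _ => P.isCompact_arc e)).isClosed
  have harcK : P.arc e ⊆ P.subImage S :=
    fun y hy => Or.inr (mem_biUnion (show e ∈ {e : G.edgeSet | _} from he) hy)
  have hKN : P.subImage S ⊆ N ∪ range γ := by
    rintro y (hy | hy)
    · exact Or.inl (Or.inl hy)
    · obtain ⟨e', he', hy⟩ := mem_iUnion₂.mp hy
      by_cases h : e' = e
      · exact Or.inr (hr ▸ h ▸ hy)
      · exact Or.inl (Or.inr (mem_biUnion (show e' ∈ {e' : G.edgeSet | _} from ⟨h, he'⟩) hy))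
  have hend : ∀ w t, w ∈ (e : Sym2 V) → γ t = P.pos w → t = 0 ∨ t = 1 := by
    intro w t hwe hwt
    rw [huv, Sym2.mem_iff] at hwe
    rcases hwe with rfl | rfl
    · exact Or.inl (hγ (hwt.trans γ.source.symm))
    · exact Or.inr (hγ (hwt.trans γ.target.symm))
  have hγe : ∀ t, γ t ∈ P.arc e := fun t => hr ▸ mem_range_self t
  have hγN : ∀ t, t ≠ 0 → t ≠ 1 → γ t ∉ N := by
    rintro t h0 h1 (⟨w, -, hwt⟩ | h)
    · exact (hend w t (P.arc_avoid e w (hwt ▸ hγe t)) hwt.symm).elim h0 h1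
    · obtain ⟨e', he', h⟩ := mem_iUnion₂.mp h
      obtain ⟨w, -, hwe, hwt⟩ := P.arc_inter e' e he'.1 _ ⟨h, hγe t⟩
      exact (hend w t hwe hwt).elim h0 h1
  have hfr : frontier C ⊆ N ∪ range γ := (frontier_component_subset hK.isClosed x).trans hKN
  have hCγ : ∀ t, γ t ∉ C := fun t h => connectedComponentIn_subset _ _ h (harcK (hγe t))
  obtain ⟨t, rfl⟩ : z ∈ range γ := hr ▸ hz
  have ht0 : t ≠ 0 := by rintro rfl; exact hzp ⟨u, γ.source.symm⟩
  have ht1 : t ≠ 1 := by rintro rfl; exact hzp ⟨v, γ.target.symm⟩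
  rw [huv, Sym2.mem_iff] at hw
  rcases hw with rfl | rfl
  · exact source_mem_closure_of_arc hC hb hN γ hγ hγN hfr hCγ ht1 hzC
  · refine source_mem_closure_of_arc hC hb hN γ.symm
      (hγ.comp unitInterval.symm_bijective.injective) ?_ ?_ (fun t => hCγ _)
      (t := unitInterval.symm t) ?_ ?_
    · intro t h0 h1
      refine hγN _ (fun h => h1 ?_) (fun h => h0 ?_)
      · simpa using congrArg unitInterval.symm h
      · simpa using congrArg unitInterval.symm h
    · rwa [Path.symm_range]
    · intro h
      exact ht0 (by simpa using congrArg unitInterval.symm h)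
    · simpa [Path.symm_apply] using hzC

/-- On each edge, `z - p` has a continuous logarithm with prescribed values at the ends, up to an
integer defect at one of them. -/
theorem exists_clog_on_edge {p : ℝ × ℝ} (hp : p ∉ P.image) {ℓ : V → ℂ}
    (hℓ : ∀ v, Complex.exp (ℓ v) = τ (P.pos v) - τ p) {e : G.edgeSet} {u v : V}
    (γ : Path (P.pos u) (P.pos v)) (hγ : Function.Injective γ) (hr : range γ = P.arc e) :
    ∃ (h : ℝ × ℝ → ℂ) (n : ℤ), ContinuousOn h (P.arc e) ∧
      (∀ z ∈ P.arc e, Complex.exp (h z) = τ z - τ p) ∧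
      h (P.pos u) = ℓ u ∧ h (P.pos v) = ℓ v + n * (2 * Real.pi * Complex.I) := by
  have hne : ∀ z ∈ P.arc e, τ z - τ p ≠ 0 := fun z hz h =>
    hp ((τ).injective (sub_eq_zero.mp h) ▸ P.arc_subset_image e hz)
  have hI : γ '' Icc 0 1 = P.arc e := by
    rw [← hr, ← image_univ]
    congr
    exact Icc_bot_top
  obtain ⟨h, hc, hexp⟩ := exists_clog_on_arc γ hγ (s := 0) (u := 1) zero_le_one
    (f := fun z => τ z - τ p) (by fun_prop) (hI ▸ hne)
  rw [hI] at hc hexp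
  have hu : P.pos u ∈ P.arc e := hr ▸ ⟨0, γ.source⟩
  have hv : P.pos v ∈ P.arc e := hr ▸ ⟨1, γ.target⟩
  have hone : Complex.exp (ℓ u - h (P.pos u)) = 1 := by
    rw [Complex.exp_sub, hℓ, hexp _ hu, div_self (hne _ hu)]
  have hexp' : ∀ z ∈ P.arc e, Complex.exp (h z + (ℓ u - h (P.pos u))) = τ z - τ p := by
    intro z hz
    rw [Complex.exp_add, hone, mul_one, hexp z hz]
  obtain ⟨n, hn⟩ := Complex.exp_eq_exp_iff_exists_int.mp ((hexp' _ hv).trans (hℓ v).symm)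
  exact ⟨fun z => h z + (ℓ u - h (P.pos u)), n, hc.add_const _, hexp', by ring, hn⟩

/-- Functions on the edges of a plane graph which agree at the vertices can be glued. -/
theorem exists_glue [Finite V] (g : V → ℂ) (k : G.edgeSet → ℝ × ℝ → ℂ)
    (hk : ∀ e, ContinuousOn (k e) (P.arc e))
    (hgk : ∀ e : G.edgeSet, ∀ w ∈ (e : Sym2 V), k e (P.pos w) = g w) :
    ∃ L : ℝ × ℝ → ℂ, ContinuousOn L P.image ∧ (∀ v, L (P.pos v) = g v) ∧
      ∀ e, ∀ z ∈ P.arc e, L z = k e z := by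
  classical
  let L : ℝ × ℝ → ℂ := fun z =>
    if h : ∃ v, P.pos v = z then g h.choose
    else if h : ∃ e, z ∈ P.arc e then k h.choose z else 0
  have hLv : ∀ v, L (P.pos v) = g v := by
    intro v
    have h : ∃ w, P.pos w = P.pos v := ⟨v, rfl⟩
    simp only [L, dif_pos h]
    rw [P.pos_inj h.choose_spec]
  have hLe : ∀ e, ∀ z ∈ P.arc e, L z = k e z := by
    intro e z hz
    by_cases h : ∃ v, P.pos v = z
    · obtain ⟨v, rfl⟩ := h
      rw [hLv, hgk e v (P.arc_avoid e v hz)]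
    · have h' : ∃ e, z ∈ P.arc e := ⟨e, hz⟩
      have : h'.choose = e := by
        by_contra hne
        obtain ⟨w, -, -, hw⟩ := P.arc_inter _ _ hne z ⟨h'.choose_spec, hz⟩
        exact h ⟨w, hw.symm⟩
      simp only [L, dif_neg h, dif_pos h', this]
  refine ⟨L, ?_, hLv, hLe⟩
  refine ContinuousOn.union_of_isClosed ((finite_range _).continuousOn _) ?_
    (finite_range _).isClosed (isClosed_iUnion_of_finite fun e => (P.isCompact_arc e).isClosed)
  exact (locallyFinite_of_finite _).continuousOn_iUnion (fun e => (P.isCompact_arc e).isClosed)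
    fun e => (hk e).congr (hLe e)

variable {P}

theorem IsFace.isOpen [Finite V] {f : Set (ℝ × ℝ)} (hf : P.IsFace f) : IsOpen f := by
  obtain ⟨x, -, rfl⟩ := hf
  exact P.isCompact_image.isClosed.isOpen_compl.connectedComponentIn

theorem IsFace.disjoint_image {f : Set (ℝ × ℝ)} (hf : P.IsFace f) : Disjoint f P.image := by
  obtain ⟨x, -, rfl⟩ := hf
  exact disjoint_left.mpr fun _ h => connectedComponentIn_subset _ _ h

theorem IsFace.nonempty {f : Set (ℝ × ℝ)} (hf : P.IsFace f) : f.Nonempty := by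
  obtain ⟨x, hx, rfl⟩ := hf
  exact ⟨x, mem_connectedComponentIn hx⟩

theorem IsFace.isPreconnected {f : Set (ℝ × ℝ)} (hf : P.IsFace f) : IsPreconnected f := by
  obtain ⟨x, hx, rfl⟩ := hf
  exact isPreconnected_connectedComponentIn

theorem IsFace.frontier_subset [Finite V] {f : Set (ℝ × ℝ)} (hf : P.IsFace f) :
    frontier f ⊆ P.image := by
  obtain ⟨x, hx, rfl⟩ := hf
  exact frontier_component_subset P.isCompact_image.isClosed x

theorem IsFace.eq_of_mem {f g : Set (ℝ × ℝ)} (hf : P.IsFace f) (hg : P.IsFace g) {z : ℝ × ℝ}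
    (hzf : z ∈ f) (hzg : z ∈ g) : f = g := by
  obtain ⟨x, -, rfl⟩ := hf
  obtain ⟨y, -, rfl⟩ := hg
  rw [connectedComponentIn_eq hzf, connectedComponentIn_eq hzg]

variable (P) in
/-- A finite plane graph has finitely many bounded faces. -/
theorem finite_boundedFaces [Finite V] : Finite {f : Set (ℝ × ℝ) // P.IsBoundedFace f} := by
  classical
  choose p hp using fun f : {f : Set (ℝ × ℝ) // P.IsBoundedFace f} => f.2.1.nonempty
  have hpK : ∀ f, p f ∉ P.image := fun f =>
    disjoint_left.mp f.2.1.disjoint_image (hp f)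
  choose u v huv γ hγ hr using P.arc_path
  let ℓ : {f : Set (ℝ × ℝ) // P.IsBoundedFace f} → V → ℂ := fun f w =>
    Complex.log (τ (P.pos w) - τ (p f))
  have hℓ : ∀ f w, Complex.exp (ℓ f w) = τ (P.pos w) - τ (p f) := fun f w =>
    Complex.exp_log fun h =>
      hpK f ((τ).injective (sub_eq_zero.mp h) ▸ P.pos_mem_image w)
  choose h n hcont hexp hu hv using fun f e =>
    P.exists_clog_on_edge (hpK f) (hℓ f) (γ e) (hγ e) (hr e)
  have hli : LinearIndependent ℤ n := by
    rw [linearIndependent_iff']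
    intro s m hm f hf
    by_contra hmf
    have hme : ∀ e, ∑ i ∈ s, m i * n i e = 0 := fun e => by
      simpa using congrFun hm e
    obtain ⟨L, hL, hLv, hLe⟩ := P.exists_glue (fun w => ∑ i ∈ s, m i * ℓ i w)
      (fun e z => ∑ i ∈ s, m i * h i e z)
      (fun e => continuousOn_finsetSum _ fun i _ => continuousOn_const.mul (hcont i e))
      (by
        intro e w hw
        rw [huv, Sym2.mem_iff] at hw
        rcases hw with rfl | rfl
        · simp only [hu]
        · simp only [hv, mul_add, Finset.sum_add_distrib, ← mul_assoc, ← Finset.sum_mul]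
          have : ∑ i ∈ s, (m i : ℂ) * n i e = 0 := by exact_mod_cast hme e
          simp [this])
    have hLexp : ∀ z ∈ P.image, Complex.exp (L z) = ∏ i ∈ s, (τ z - τ (p i)) ^ m i := by
      rintro z (⟨w, rfl⟩ | hz)
      · rw [hLv, Complex.exp_sum]
        exact Finset.prod_congr rfl fun i _ => by rw [Complex.exp_int_mul, hℓ]
      · obtain ⟨e, he⟩ := mem_iUnion.mp hz
        rw [hLe e z he, Complex.exp_sum]
        exact Finset.prod_congr rfl fun i _ => by rw [Complex.exp_int_mul, hexp i e z he]
    have hne : ∀ i ∈ s.erase f, ∀ z ∈ closure f.1, τ z - τ (p i) ≠ 0 := by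
      intro i hi z hz h0
      have hzi : z ∈ i.1 := (τ).injective (sub_eq_zero.mp h0) ▸ hp i
      obtain ⟨y, hyi, hyf⟩ := mem_closure_iff.mp hz _ i.2.1.isOpen hzi
      exact Finset.ne_of_mem_erase hi (Subtype.ext (i.2.1.eq_of_mem f.2.1 hyi hyf))
    refine not_exists_clog_on_frontier f.2.1.isOpen f.2.2 (hp f) hmf
      (F := fun z => ∏ i ∈ s.erase f, (τ z - τ (p i)) ^ m i) ?_ ?_
      (hL.mono f.2.1.frontier_subset) ?_
    · exact continuousOn_finsetProd _ fun i hi =>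
        ContinuousOn.zpow₀ (by fun_prop) _ fun z hz => Or.inl (hne i hi z hz)
    · exact fun z hz => Finset.prod_ne_zero_iff.mpr fun i hi => zpow_ne_zero _ (hne i hi z hz)
    · intro z hz
      rw [hLexp z (f.2.1.frontier_subset hz),
        Finset.mul_prod_erase s (fun i => (τ z - τ (p i)) ^ m i) hf]
  exact hli.finite_of_isNoetherian

variable (P) in
/-- The union of the unbounded components of the complement of the drawing induced by `S`. -/
def outerRegion (S : Set V) : Set (ℝ × ℝ) :=
  {x | x ∉ P.subImage S ∧ ¬ IsBounded (connectedComponentIn (P.subImage S)ᶜ x)}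

theorem component_subset_outerRegion {S : Set V} {x : ℝ × ℝ} (hx : x ∈ P.outerRegion S) :
    connectedComponentIn (P.subImage S)ᶜ x ⊆ P.outerRegion S := fun _ hy =>
  ⟨connectedComponentIn_subset _ _ hy, connectedComponentIn_eq hy ▸ hx.2⟩

theorem isOpen_outerRegion [Finite V] (S : Set V) : IsOpen (P.outerRegion S) :=
  isOpen_iff_mem_nhds.mpr fun _ hx => Filter.mem_of_superset
    ((P.isCompact_subImage S).isClosed.isOpen_compl.connectedComponentIn.mem_nhds
      (mem_connectedComponentIn hx.1)) (component_subset_outerRegion hx)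

theorem subImage_empty : P.subImage ∅ = ∅ := by
  refine eq_empty_of_forall_notMem ?_
  rintro x (⟨v, hv, -⟩ | h)
  · exact hv
  · obtain ⟨e, he, -⟩ := mem_iUnion₂.mp h
    obtain ⟨u, v, huv, -⟩ := P.arc_path e
    exact he u (by simp [huv])

/-- A point of an outerplanar layer, once removed, belongs to the outer region. -/
theorem pos_mem_outerRegion_of_mem_closure {S S' : Set V} (hS : S' ⊆ S) {x : ℝ × ℝ}
    (hx : ¬ IsBounded (connectedComponentIn (P.subImage S)ᶜ x)) {v : V} (hv : v ∉ S')
    (hvx : P.pos v ∈ closure (connectedComponentIn (P.subImage S)ᶜ x)) :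
    P.pos v ∈ P.outerRegion S' := by
  have hvS : P.pos v ∉ P.subImage S' := fun h => hv (P.pos_mem_subImage_iff.mp h)
  refine ⟨hvS, fun hb => hx (hb.subset ?_)⟩
  exact subset_component_of_mem_closure isPreconnected_connectedComponentIn
    (disjoint_left.mpr fun y hy hy' =>
      absurd (P.subImage_mono hS hy') (connectedComponentIn_subset _ _ hy)) hvx hvS

/-- A bounded face lying in the outer region of `S` has a vertex outside `S` on its boundary. -/
theorem IsBoundedFace.exists_boundaryVert_notMem [Finite V] {f : Set (ℝ × ℝ)}
    (hf : P.IsBoundedFace f) {S : Set V} {y : ℝ × ℝ} (hyf : y ∈ f) (hy : y ∈ P.outerRegion S) :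
    ∃ v ∈ P.boundaryVerts f, v ∉ S := by
  by_contra! hall
  have hfr : frontier f ⊆ P.subImage S := by
    intro z hz
    by_cases hzp : z ∈ range P.pos
    · obtain ⟨w, rfl⟩ := hzp
      exact P.pos_mem_subImage_iff.mpr (hall w (frontier_subset_closure hz))
    · rcases hf.1.frontier_subset hz with h | h
      · exact absurd h hzp
      obtain ⟨e, he⟩ := mem_iUnion.mp h
      obtain ⟨x, -, hx⟩ := hf.1
      rw [P.image_eq_subImage] at hx
      refine Or.inr (mem_biUnion (show e ∈ {e : G.edgeSet | _} from fun w hw => hall w ?_) he)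
      have := P.pos_mem_closure_of_edge x (fun _ _ => mem_univ _) he hzp
        (hx ▸ frontier_subset_closure hz) hw
      exact hx ▸ this
  refine hy.2 (hf.2.subset ?_)
  refine isPreconnected_connectedComponentIn.subset_of_closure_inter_subset hf.1.isOpen
    ⟨y, mem_connectedComponentIn hy.1, hyf⟩ ?_
  rintro z ⟨hz, hzC⟩
  by_contra hzf
  refine connectedComponentIn_subset _ _ hzC (hfr ?_)
  rw [hf.1.isOpen.frontier_eq]
  exact ⟨hz, hzf⟩

/-- Away from the primal drawing, a dual arc stays in the two faces it joins. -/
theorem exists_face_of_mem_dual_arc {Q : PlaneEmbedding P.weakDual}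
    (hQ : IsCompatibleDualEmbedding P Q) {d : P.weakDual.edgeSet} {z : ℝ × ℝ}
    (hz : z ∈ Q.arc d) (hzP : z ∉ P.image) :
    ∃ f ∈ (d : Sym2 {f : Set (ℝ × ℝ) // P.IsBoundedFace f}), z ∈ f.1 := by
  obtain ⟨u, v, hd, γ, hγ, hr⟩ := Q.arc_path d
  obtain ⟨-, -, -, -, -, -, x, hx, -⟩ := hQ.2 d
  have hxm : x ∈ Q.arc d ∩ P.image := hx ▸ mem_singleton x
  obtain ⟨t₀, rfl⟩ : x ∈ range γ := hr ▸ hxm.1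
  have huniq : ∀ t, γ t ∈ P.image → t = t₀ := fun t ht =>
    hγ (mem_singleton_iff.mp (hx ▸ ⟨hr ▸ mem_range_self t, ht⟩ : γ t ∈ ({γ t₀} : Set (ℝ × ℝ))))
  have key : ∀ (I : Set unitInterval) (f : {f : Set (ℝ × ℝ) // P.IsBoundedFace f})
      (s t : unitInterval), I.OrdConnected → t₀ ∉ I → s ∈ I → t ∈ I → γ s = Q.pos f →
      γ t ∈ f.1 := by
    intro I f s t hI h₀ hs ht hsf
    obtain ⟨⟨y, -, hy⟩, -⟩ := f.2
    have hsy : γ s ∈ connectedComponentIn (P.image)ᶜ y := hy ▸ hsf ▸ hQ.1 f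
    rw [hy, connectedComponentIn_eq hsy]
    refine (hI.isPreconnected.image γ γ.continuous.continuousOn).subset_connectedComponentIn
      (mem_image_of_mem γ hs) ?_ (mem_image_of_mem γ ht)
    rintro _ ⟨r, hr, rfl⟩ h
    exact h₀ (huniq r h ▸ hr)
  obtain ⟨t, rfl⟩ : z ∈ range γ := hr ▸ hz
  have hne : t ≠ t₀ := fun h => hzP (h ▸ hxm.2)
  have h0 : t₀ ≠ 0 := by
    rintro rfl
    exact disjoint_left.mp u.2.1.disjoint_image (hQ.1 u) (by simpa using hxm.2)
  have h1 : t₀ ≠ 1 := by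
    rintro rfl
    exact disjoint_left.mp v.2.1.disjoint_image (hQ.1 v) (by simpa using hxm.2)
  rcases lt_or_gt_of_ne hne with h | h
  · exact ⟨u, by simp [hd], key (Iio t₀) u 0 t ordConnected_Iio (lt_irrefl t₀)
      (lt_of_le_of_ne unitInterval.nonneg' h0.symm) h γ.source⟩
  · exact ⟨v, by simp [hd], key (Ioi t₀) v 1 t ordConnected_Ioi (lt_irrefl t₀)
      (lt_of_le_of_ne unitInterval.le_one' h1) h γ.target⟩

/-- The drawing of the dual on faces outside the outer region avoids the outer region. -/
theorem disjoint_outerRegion_dual_subImage [Finite V] {Q : PlaneEmbedding P.weakDual}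
    (hQ : IsCompatibleDualEmbedding P Q) {S : Set V}
    {T : Set {f : Set (ℝ × ℝ) // P.IsBoundedFace f}}
    (hT : ∀ f ∈ T, Disjoint f.1 (P.outerRegion S)) :
    Disjoint (P.outerRegion S) (Q.subImage T) := by
  refine disjoint_left.mpr ?_
  rintro z hzO (⟨f, hf, rfl⟩ | hz)
  · exact disjoint_left.mp (hT f hf) (hQ.1 f) hzO
  obtain ⟨d, hd, hz⟩ := mem_iUnion₂.mp hz
  by_cases hzP : z ∈ P.image
  · obtain ⟨f, g, e, hfg, hef, -, x, hx, hxe, -⟩ := hQ.2 d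
    have hzx : z = x := mem_singleton_iff.mp (hx ▸ ⟨hz, hzP⟩ : z ∈ ({x} : Set (ℝ × ℝ)))
    obtain ⟨y, hyO, hyf⟩ := mem_closure_iff.mp (hef (hzx ▸ hxe)) _ (isOpen_outerRegion S) hzO
    exact disjoint_left.mp (hT f (hd f (by simp [hfg]))) hyf hyO
  · obtain ⟨f, hf, hzf⟩ := exists_face_of_mem_dual_arc hQ hz hzP
    exact disjoint_left.mp (hT f (hd f hf)) hzf hzO

theorem pos_notMem_dual_subImage {Q : PlaneEmbedding P.weakDual}
    (hQ : IsCompatibleDualEmbedding P Q) (v : V)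
    (T : Set {f : Set (ℝ × ℝ) // P.IsBoundedFace f}) : P.pos v ∉ Q.subImage T := by
  rintro (⟨f, -, h⟩ | h)
  · exact disjoint_left.mp f.2.1.disjoint_image (hQ.1 f) (h ▸ P.pos_mem_image v)
  · obtain ⟨d, -, h⟩ := mem_iUnion₂.mp h
    obtain ⟨-, -, -, -, -, -, x, hx, -, hxv⟩ := hQ.2 d
    exact hxv ⟨v, mem_singleton_iff.mp
      (hx ▸ ⟨h, P.pos_mem_image v⟩ : P.pos v ∈ ({x} : Set (ℝ × ℝ)))⟩

/-- A face of `T` meeting an unbounded component of the complement of the dual drawing of `T` is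
one of the outer vertices of this drawing. -/
theorem mem_outerVerts_dual_of_inter_nonempty [Finite V] {Q : PlaneEmbedding P.weakDual}
    (hQ : IsCompatibleDualEmbedding P Q) {T : Set {f : Set (ℝ × ℝ) // P.IsBoundedFace f}}
    {f : {f : Set (ℝ × ℝ) // P.IsBoundedFace f}} (hf : f ∈ T) {x : ℝ × ℝ}
    (hx : x ∈ Q.outerRegion T)
    (hxf : (f.1 ∩ connectedComponentIn (Q.subImage T)ᶜ x).Nonempty) : f ∈ Q.outerVerts T := by
  have := P.finite_boundedFaces
  have hL := (Q.isCompact_subImage T).isClosed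
  refine ⟨hf, x, hx.1, hx.2, ?_⟩
  by_contra hcl
  have hfU : ¬ f.1 ⊆ connectedComponentIn (Q.subImage T)ᶜ x := fun h =>
    hcl (subset_closure (h (hQ.1 f)))
  refine hfU (f.2.1.isPreconnected.subset_of_closure_inter_subset
    hL.isOpen_compl.connectedComponentIn hxf ?_)
  rintro z ⟨hz, hzf⟩
  by_contra hzU
  have hzL : z ∈ Q.subImage T := frontier_component_subset hL x
    (by rw [hL.isOpen_compl.connectedComponentIn.frontier_eq]; exact ⟨hz, hzU⟩)
  have hzp : z ∉ range Q.pos := by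
    rintro ⟨g, rfl⟩
    rw [Subtype.ext (g.2.1.eq_of_mem f.2.1 (hQ.1 g) hzf)] at hz
    exact hcl hz
  rcases hzL with ⟨g, -, h⟩ | h
  · exact hzp ⟨g, h⟩
  obtain ⟨d, hd, hzd⟩ := mem_iUnion₂.mp h
  obtain ⟨g, hg, hzg⟩ := exists_face_of_mem_dual_arc hQ hzd
    (disjoint_left.mp f.2.1.disjoint_image hzf)
  obtain rfl : g = f := Subtype.ext (g.2.1.eq_of_mem f.2.1 hzg hzf)
  exact hcl (Q.pos_mem_closure_of_edge x hd hzd hzp hz hg)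

/-- Peeling the dual keeps up with peeling the primal: the faces that survive are disjoint from
the outer region. -/
theorem disjoint_outerRegion_peel [Finite V] {Q : PlaneEmbedding P.weakDual}
    (hQ : IsCompatibleDualEmbedding P Q) {S : Set V} (hS : ∀ v ∉ S, P.pos v ∈ P.outerRegion S)
    {T : Set {f : Set (ℝ × ℝ) // P.IsBoundedFace f}}
    (hT : ∀ f ∈ T, Disjoint f.1 (P.outerRegion S)) :
    ∀ f ∈ Q.peel T, Disjoint f.1 (P.outerRegion (P.peel S)) := by
  rintro f ⟨hfT, hfo⟩
  refine disjoint_left.mpr fun y hyf hy => hfo ?_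
  obtain ⟨v, hvf, hvS⟩ := f.2.exists_boundaryVert_notMem hyf hy
  obtain ⟨x, hx, hvx⟩ : ∃ x ∈ P.outerRegion S,
      P.pos v ∈ closure (connectedComponentIn (P.subImage S)ᶜ x) := by
    by_cases hv : v ∈ S
    · obtain ⟨-, x, h1, h2, h3⟩ := not_not.mp fun h => hvS ⟨hv, h⟩
      exact ⟨x, ⟨h1, h2⟩, h3⟩
    · exact ⟨_, hS v hv, subset_closure (mem_connectedComponentIn (hS v hv).1)⟩
  have hvL : P.pos v ∉ Q.subImage T := pos_notMem_dual_subImage hQ v T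
  have hCU := subset_component_of_mem_closure isPreconnected_connectedComponentIn
    ((disjoint_outerRegion_dual_subImage hQ hT).mono_left (component_subset_outerRegion hx))
    hvx hvL
  have := P.finite_boundedFaces
  refine mem_outerVerts_dual_of_inter_nonempty hQ hfT (x := P.pos v)
    ⟨hvL, fun hb => hx.2 (hb.subset hCU)⟩ ?_
  rw [inter_comm]
  exact mem_closure_iff.mp hvf _
    (Q.isCompact_subImage T).isClosed.isOpen_compl.connectedComponentIn
    (mem_connectedComponentIn hvL)

theorem pos_mem_outerRegion_peel {S : Set V} (hS : ∀ v ∉ S, P.pos v ∈ P.outerRegion S) :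
    ∀ v ∉ P.peel S, P.pos v ∈ P.outerRegion (P.peel S) := by
  intro v hv
  by_cases hvS : v ∈ S
  · obtain ⟨-, x, -, h2, h3⟩ := not_not.mp fun h => hv ⟨hvS, h⟩
    exact pos_mem_outerRegion_of_mem_closure sdiff_subset h2 hv h3
  · exact pos_mem_outerRegion_of_mem_closure sdiff_subset (hS v hvS).2 hv
      (subset_closure (mem_connectedComponentIn (hS v hvS).1))

end PlaneEmbedding

/-- If `G` is a `k`-outerplanar plane graph, then its weak dual,
with its induced plane embedding, is at most `k`-outerplanar. -/
theorem weakDual_outerplanar {V : Type} [Fintype V] {G : SimpleGraph V}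
    (P : PlaneEmbedding G) (k : ℕ) (hk : P.OuterplanarAtMost k)
    (Q : PlaneEmbedding P.weakDual) (hQ : IsCompatibleDualEmbedding P Q) :
    Q.OuterplanarAtMost k := by
  have key : ∀ i, (∀ v ∉ (P.peel)^[i] univ, P.pos v ∈ P.outerRegion ((P.peel)^[i] univ)) ∧
      ∀ f ∈ (Q.peel)^[i] univ, Disjoint f.1 (P.outerRegion ((P.peel)^[i] univ)) := by
    intro i
    induction i with
    | zero =>
      refine ⟨fun v hv => absurd (mem_univ v) hv, fun f _ => ?_⟩
      refine disjoint_left.mpr fun y hyf hy => ?_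
      obtain ⟨v, -, hv⟩ := f.2.exists_boundaryVert_notMem hyf hy
      exact hv (mem_univ v)
    | succ i ih =>
      simp only [Function.iterate_succ_apply']
      exact ⟨PlaneEmbedding.pos_mem_outerRegion_peel ih.1,
        PlaneEmbedding.disjoint_outerRegion_peel hQ ih.1 ih.2⟩
  refine eq_empty_of_forall_notMem fun f hf => ?_
  have hdis := (key k).2 f hf
  rw [show (P.peel)^[k] univ = ∅ from hk] at hdis
  refine disjoint_left.mp hdis (hQ.1 f) ⟨by simp [PlaneEmbedding.subImage_empty], fun hb => ?_⟩
  rw [PlaneEmbedding.subImage_empty, compl_empty, connectedComponentIn_univ,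
    PreconnectedSpace.connectedComponent_eq_univ] at hb
  exact NormedSpace.unbounded_univ ℝ (ℝ × ℝ) hb
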